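/- arXiv:2108.12404 — 4 statements merged into one kernel-verified Lean document; each statement's English description precedes it below -/
import Mathlib

section
/- Let 0 → ℤ → Γ̃ →^π Γ → 1 be a central extension of a residually finite group Γ by ℤ, and let σ ∈ Γ̃ denote the image of 1 ∈ ℤ. If there exist a residually finite group H and a group homomorphism φ: Γ̃ → H whose restriction to the cyclic subgroup ⟨σ⟩ is injective (equivalently, φ(σ^i) ≠ 1 for every nonzero integer i), then Γ̃ is residually finite. -/
/-- A group `G` is residually finite if for every `g ∈ G` with `g ≠ 1` there exist a
finite group `F` and a group homomorphism `ρ : G → F` with `ρ g ≠ 1`. -/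
def ResiduallyFinite (G : Type*) [Group G] : Prop :=
  ∀ g : G, g ≠ 1 → ∃ (F : Type) (_ : Group F) (_ : Finite F) (ρ : G →* F), ρ g ≠ 1

/-- Let `0 → ℤ → Γ̃ → Γ → 1` be a central extension of a residually finite group `Γ` by `ℤ`,
where `σ` is the image of `1 ∈ ℤ`, so `ker π = ⟨σ⟩` is infinite cyclic and central.  If there
are a residually finite group `H` and a homomorphism `φ : Γ̃ → H` whose restriction to `⟨σ⟩`
is injective (equivalently, `φ (σ ^ i) ≠ 1` for all nonzero integers `i`), then `Γ̃` is
residually finite. -/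
theorem residuallyFinite_of_rf_quotient
    {Γt Γ : Type*} [Group Γt] [Group Γ]
    (π : Γt →* Γ) (hsurj : Function.Surjective π)
    (σ : Γt) (hker : π.ker = Subgroup.zpowers σ)
    (hcen : σ ∈ Subgroup.center Γt) (hinf : ¬ IsOfFinOrder σ)
    (hΓ : ResiduallyFinite Γ)
    (H : Type*) [Group H] (hH : ResiduallyFinite H)
    (φ : Γt →* H) (hφ : ∀ i : ℤ, i ≠ 0 → φ (σ ^ i) ≠ 1) :
    ResiduallyFinite Γt := by
  intro g hg
  by_cases hπ : π g = 1
  · have hmem : g ∈ Subgroup.zpowers σ := hker ▸ π.mem_ker.mpr hπ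
    obtain ⟨i, rfl⟩ := Subgroup.mem_zpowers_iff.mp hmem
    have hi : i ≠ 0 := by
      rintro rfl
      exact hg (zpow_zero σ)
    obtain ⟨F, hF, hfin, ρ, hρ⟩ := hH _ (hφ i hi)
    exact ⟨F, hF, hfin, ρ.comp φ, hρ⟩
  · obtain ⟨F, hF, hfin, ρ, hρ⟩ := hΓ _ hπ
    exact ⟨F, hF, hfin, ρ.comp π, hρ⟩
end

section
/- Let 0 → ℤ → Γ̃ →^π Γ → 1 be a central extension of a residually finite group Γ by ℤ, with Γ̃ finitely generated, and let σ ∈ Γ̃ denote the image of 1 ∈ ℤ. If the extension satisfies condition N, i.e., there exist a nilpotent group N and a surjective homomorphism f: Γ̃ → N such that f(σ) has infinite order, then Γ̃ is residually finite. -/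
open Subgroup in
/-- A subgroup is finitely generated if its image under a homomorphism and its intersection with
the kernel are. -/
theorem Subgroup.fg_of_fg_map_of_fg_inf_ker {G Q : Type*} [Group G] [Group Q] (f : G →* Q)
    {H : Subgroup G} (hmap : (H.map f).FG) (hinf : (H ⊓ f.ker).FG) : H.FG := by
  classical
  obtain ⟨T, hT⟩ := hmap
  have hTH : (T : Set Q) ⊆ f '' H := by
    rw [← coe_map, ← hT]
    exact subset_closure
  obtain ⟨S, hSH, rfl⟩ := Finset.subset_set_image_iff.mp hTH
  have hclosure : closure (S : Set G) ≤ H := (closure_le H).mpr hSH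
  have hH : closure (S : Set G) ⊔ (H ⊓ f.ker) = H := by
    refine le_antisymm (sup_le hclosure inf_le_left) fun x hx => ?_
    have hfx : f x ∈ (closure (S : Set G)).map f := by
      rw [MonoidHom.map_closure, ← Finset.coe_image, hT]
      exact mem_map_of_mem f hx
    obtain ⟨y, hy, hyx⟩ := hfx
    rw [← mul_inv_cancel_left y x]
    refine mul_mem_sup hy ⟨H.mul_mem (H.inv_mem (hclosure hy)) hx, ?_⟩
    simp [hyx]
  rw [← hH]
  exact FG.sup ⟨S, rfl⟩ hinf

/-- Subgroups of finitely generated central subgroups are finitely generated. -/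
theorem Subgroup.FG.of_le_of_le_center {G : Type*} [Group G] {K L : Subgroup G} (hK : K.FG)
    (hcen : K ≤ center G) (hL : L ≤ K) : L.FG := by
  let _ : CommGroup K :=
    { (inferInstance : Group K) with
      mul_comm := fun a b => Subtype.ext (mem_center_iff.mp (hcen b.2) a) }
  have : Group.FG K := (Group.fg_iff_subgroup_fg K).mpr hK
  have : Module.Finite ℤ (Additive K) := Module.Finite.iff_addGroup_fg.mpr inferInstance
  have hfg : (L.subgroupOf K).FG := by
    rw [Subgroup.fg_iff_add_fg]
    have h := IsNoetherian.noetherian (AddSubgroup.toIntSubmodule (L.subgroupOf K).toAddSubgroup)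
    rwa [Submodule.fg_iff_addSubgroup_fg] at h
  obtain ⟨S, hS⟩ := hfg
  classical
  refine ⟨S.image K.subtype, ?_⟩
  rw [Finset.coe_image, ← MonoidHom.map_closure, hS, Subgroup.map_subgroupOf_eq_of_le hL]

open Subgroup commutatorElement in
/-- In a finitely generated group, if `⁅H, ⊤⁆` is central and the image of `H` modulo `⁅H, ⊤⁆` is
finitely generated, then so is `⁅H, ⊤⁆`. -/
theorem Subgroup.fg_commutator_top {G : Type*} [Group G] [hG : Group.FG G] {H : Subgroup G}
    [H.Normal] (hcen : ⁅H, (⊤ : Subgroup G)⁆ ≤ center G)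
    (hH : (H.map (QuotientGroup.mk' ⁅H, (⊤ : Subgroup G)⁆)).FG) :
    ⁅H, (⊤ : Subgroup G)⁆.FG := by
  classical
  obtain ⟨T, hT⟩ := hH
  obtain ⟨A, hA⟩ := Group.fg_def.mp hG
  have hTH : (T : Set _) ⊆ QuotientGroup.mk' ⁅H, (⊤ : Subgroup G)⁆ '' H := by
    rw [← coe_map, ← hT]
    exact subset_closure
  obtain ⟨S, hSH, rfl⟩ := Finset.subset_set_image_iff.mp hTH
  let C : Subgroup G := closure ((S ×ˢ A).image fun p => ⁅p.1, p.2⁆ : Finset G)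
  have hC : C ≤ ⁅H, (⊤ : Subgroup G)⁆ := by
    refine (closure_le _).mpr fun x hx => ?_
    obtain ⟨p, hp, rfl⟩ := Finset.mem_image.mp hx
    exact commutator_mem_commutator (hSH (Finset.mem_product.mp hp).1) (mem_top _)
  have hCn : C.Normal := ⟨fun x hx g => by
    rwa [mem_center_iff.mp (hcen (hC hx)) g, mul_inv_cancel_right]⟩
  let Z : Subgroup G := (center (G ⧸ C)).comap (QuotientGroup.mk' C)
  have hmem (x : G) : x ∈ Z ↔ ∀ g, ⁅x, g⁆ ∈ C := by
    simp only [Z, mem_comap, mem_center_iff, QuotientGroup.forall_mk (s := C)]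
    refine forall_congr' fun g => ?_
    rw [← QuotientGroup.eq_one_iff, ← QuotientGroup.mk'_apply C ⁅x, g⁆, map_commutatorElement,
      commutatorElement_eq_one_iff_mul_comm]
    exact eq_comm
  have hSZ : (S : Set G) ⊆ Z := by
    intro s hs
    have hA' : closure (A : Set G) ≤
        (centralizer {QuotientGroup.mk' C s}).comap (QuotientGroup.mk' C) := by
      refine (closure_le _).mpr fun a ha => ?_
      rw [SetLike.mem_coe, mem_comap, mem_centralizer_singleton_iff, eq_comm,
        ← commutatorElement_eq_one_iff_mul_comm, ← map_commutatorElement, QuotientGroup.mk'_apply,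
        QuotientGroup.eq_one_iff]
      exact subset_closure (Finset.mem_image.mpr ⟨(s, a), Finset.mk_mem_product hs ha, rfl⟩)
    rw [hA] at hA'
    refine mem_center_iff.mpr fun g => ?_
    obtain ⟨g, rfl⟩ := QuotientGroup.mk'_surjective C g
    exact mem_centralizer_singleton_iff.mp (hA' (mem_top g))
  have hKZ : ⁅H, (⊤ : Subgroup G)⁆ ≤ Z := fun x hx => (hmem x).mpr fun g => by
    rw [commutatorElement_eq_one_iff_mul_comm.mpr (mem_center_iff.mp (hcen hx) g).symm]
    exact C.one_mem
  have hHZ : H ≤ Z := by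
    intro x hx
    have hfx : QuotientGroup.mk' ⁅H, (⊤ : Subgroup G)⁆ x ∈
        (closure (S : Set G)).map (QuotientGroup.mk' ⁅H, (⊤ : Subgroup G)⁆) := by
      rw [MonoidHom.map_closure, ← Finset.coe_image, hT]
      exact mem_map_of_mem _ hx
    obtain ⟨y, hy, hyx⟩ := hfx
    rw [← mul_inv_cancel_left y x]
    exact Z.mul_mem ((closure_le Z).mpr hSZ hy) (hKZ (QuotientGroup.eq.mp hyx))
  have hle : ⁅H, (⊤ : Subgroup G)⁆ ≤ C :=
    commutator_le.mpr fun x hx g _ => (hmem x).mp (hHZ hx) g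
  rw [le_antisymm hle hC]
  exact ⟨_, rfl⟩

open Subgroup in
/-- Every subgroup of a finitely generated group with terminating lower central series is finitely
generated. -/
theorem Subgroup.fg_of_lowerCentralSeries_eq_bot (n : ℕ) : ∀ {G : Type*} [Group G] [Group.FG G],
    (⊤ : Subgroup G).lowerCentralSeries (n + 1) = ⊥ → ∀ H : Subgroup G, H.FG := by
  induction n with
  | zero =>
    intro G _ hG h H
    refine (Group.fg_def.mp hG).of_le_of_le_center ?_ le_top
    rw [zero_add, top_lowerCentralSeries_one, _root_.commutator_def,
      commutator_eq_bot_iff_le_centralizer, coe_top, centralizer_univ] at h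
    exact h
  | succ n ih =>
    intro G _ hG h H
    let D := (⊤ : Subgroup G).lowerCentralSeries n
    let K := ⁅D, (⊤ : Subgroup G)⁆
    have hK : K ≤ center G := by
      have : ⁅K, (⊤ : Subgroup G)⁆ = ⊥ := h
      rw [commutator_eq_bot_iff_le_centralizer, coe_top, centralizer_univ] at this
      exact this
    have hquot : (⊤ : Subgroup (G ⧸ K)).lowerCentralSeries (n + 1) = ⊥ := by
      rw [← map_top_of_surjective _ (QuotientGroup.mk'_surjective K), ← map_lowerCentralSeries]
      exact (map_eq_bot_iff _).mpr (QuotientGroup.ker_mk' K).ge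
    have hKfg : K.FG := fg_commutator_top hK (ih hquot _)
    refine fg_of_fg_map_of_fg_inf_ker (QuotientGroup.mk' K) (ih hquot _) ?_
    rw [QuotientGroup.ker_mk']
    exact hKfg.of_le_of_le_center hK inf_le_right

/-- Every subgroup of a finitely generated nilpotent group is finitely generated. -/
theorem Group.IsNilpotent.subgroup_fg {G : Type*} [Group G] [Group.FG G] [Group.IsNilpotent G]
    (H : Subgroup G) : H.FG := by
  obtain ⟨n, hn⟩ := Subgroup.nilpotent_iff_lowerCentralSeries.mp ‹Group.IsNilpotent G›
  exact Subgroup.fg_of_lowerCentralSeries_eq_bot n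
    (le_bot_iff.mp (hn ▸ Subgroup.lowerCentralSeries_antitone _ n.le_succ)) H

open Subgroup in
/-- If the center of a finitely generated nilpotent group is torsion, then it is finite. -/
theorem Group.IsNilpotent.finite_center {G : Type*} [Group G] [Group.FG G] [Group.IsNilpotent G]
    (h : ∀ z ∈ center G, IsOfFinOrder z) : Finite (center G) := by
  let _ : CommGroup (center G) :=
    { (inferInstance : Group (center G)) with
      mul_comm := fun a b => Subtype.ext (mem_center_iff.mp b.2 a) }
  have : Group.FG (center G) := (Group.fg_iff_subgroup_fg _).mpr (subgroup_fg _)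
  exact CommGroup.finite_of_fg_isMulTorsion _ fun z =>
    (Subgroup.subtype_injective _).isOfFinOrder_iff.mp (h z z.2)

open Subgroup in
/-- If the center of `G` has exponent dividing `m`, so does the center of `G ⧸ center G`. -/
theorem pow_eq_one_of_mem_center_quotient_center {G : Type*} [Group G] {m : ℕ}
    (h : ∀ z ∈ center G, z ^ m = 1) (x : G ⧸ center G) (hx : x ∈ center (G ⧸ center G)) :
    x ^ m = 1 := by
  obtain ⟨x, rfl⟩ := QuotientGroup.mk_surjective x
  rw [← QuotientGroup.mk_pow, QuotientGroup.eq_one_iff, mem_center_iff]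
  intro g
  have hc : g * x * g⁻¹ * x⁻¹ ∈ center G := by
    rw [← QuotientGroup.eq_one_iff]
    simp only [QuotientGroup.mk_mul, QuotientGroup.mk_inv, mem_center_iff.mp hx g]
    group
  have hgx : g * x * g⁻¹ = (g * x * g⁻¹ * x⁻¹) * x := by group
  have hcomm : Commute (g * x * g⁻¹ * x⁻¹) x := (mem_center_iff.mp hc x).symm
  rw [← mul_inv_eq_iff_eq_mul, ← conj_pow, hgx, hcomm.mul_pow, h _ hc, one_mul]

open Subgroup in
/-- A finitely generated nilpotent group whose center has finite exponent is finite. -/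
theorem Group.IsNilpotent.finite_of_center_pow_eq_one {G : Type*} [Group G] [Group.FG G]
    [Group.IsNilpotent G] {m : ℕ} (hm : 0 < m) (h : ∀ z ∈ center G, z ^ m = 1) : Finite G := by
  refine Group.nilpotent_center_quotient_ind
    (P := fun G _ _ => Group.FG G → (∀ z ∈ center G, z ^ m = 1) → Finite G) G ?_ ?_ ‹_› h
  · intro G _ _ _ _
    infer_instance
  · intro G _ _ ih _ h
    have : Finite (G ⧸ center G) := ih inferInstance (pow_eq_one_of_mem_center_quotient_center h)
    have : Finite (center G) :=
      finite_center fun z hz => isOfFinOrder_iff_pow_eq_one.mpr ⟨m, hm, h z hz⟩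
    exact .of_subgroup_quotient (center G)

open Subgroup in
/-- Finitely generated nilpotent groups are residually finite: a normal subgroup maximal among those
avoiding `z` has finite index. -/
theorem Group.IsNilpotent.exists_normal_finite_quotient {G : Type*} [Group G] [Group.FG G]
    [Group.IsNilpotent G] {z : G} (hz : z ≠ 1) :
    ∃ M : Subgroup G, M.Normal ∧ Finite (G ⧸ M) ∧ z ∉ M := by
  obtain ⟨M, hM⟩ : ∃ M : Subgroup G, Maximal (fun M => M.Normal ∧ z ∉ M) M := by
    refine zorn_le_nonempty₀ {M : Subgroup G | M.Normal ∧ z ∉ M} ?_ ⊥ ⟨inferInstance, hz⟩ |>.imp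
      fun M hM => hM.2
    intro c hc hchain M hMc
    refine ⟨sSup c, ⟨?_, ?_⟩, fun N hN => le_sSup hN⟩
    · exact sSup_normal c fun N hN => (hc hN).1
    · rw [mem_sSup_of_directedOn ⟨M, hMc⟩ hchain.directedOn]
      rintro ⟨N, hN, hzN⟩
      exact (hc hN).2 hzN
  obtain ⟨hMn, hzM⟩ := hM.prop
  refine ⟨M, hMn, ?_, hzM⟩
  have hmin (w : G ⧸ M) (hw : w ∈ center (G ⧸ M)) (hw1 : w ≠ 1) : (z : G ⧸ M) ∈ zpowers w := by
    have hn : (zpowers w).Normal := ⟨fun x hx g => by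
      rwa [mem_center_iff.mp (zpowers_le.mpr hw hx) g, mul_inv_cancel_right]⟩
    by_contra hzw
    have hle : M ≤ (zpowers w).comap (QuotientGroup.mk' M) := fun x hx => by
      simp [mem_comap, (QuotientGroup.eq_one_iff x).mpr hx]
    have := hM.le_of_ge (y := (zpowers w).comap (QuotientGroup.mk' M)) ⟨inferInstance, hzw⟩ hle
    obtain ⟨x, rfl⟩ := QuotientGroup.mk_surjective w
    exact hw1 ((QuotientGroup.eq_one_iff x).mpr (this (mem_zpowers (x : G ⧸ M))))
  have : Finite (center (G ⧸ M)) := finite_center fun w hw => by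
    by_contra hinf
    have hw1 : w ≠ 1 := fun h => hinf (h ▸ .one)
    obtain ⟨k, hk⟩ := mem_zpowers_iff.mp (hmin w hw hw1)
    have hk0 : k ≠ 0 := by
      rintro rfl
      exact hzM ((QuotientGroup.eq_one_iff z).mp (by rw [← hk, zpow_zero]))
    have hinj := injective_zpow_iff_not_isOfFinOrder.mpr hinf
    obtain ⟨l, hl⟩ := mem_zpowers_iff.mp (hmin (w ^ (2 * k)) (zpow_mem hw _) fun h =>
      mul_ne_zero two_ne_zero hk0 (hinj (h.trans (zpow_zero w).symm)))
    rw [← hk, ← zpow_mul] at hl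
    have hlk : (2 * l) * k = 1 * k := by linear_combination hinj hl
    have := mul_right_cancel₀ hk0 hlk
    omega
  exact finite_of_center_pow_eq_one (Nat.card_pos (α := center (G ⧸ M))) fun w hw =>
    congrArg Subtype.val (pow_card_eq_one' (x := (⟨w, hw⟩ : center (G ⧸ M))))

/-- Let `0 → ℤ → Γ̃ → Γ → 1` be a central extension of a residually finite group `Γ` by `ℤ`,
with `Γ̃` finitely generated, where `σ` is the image of `1 ∈ ℤ`, so `ker π = ⟨σ⟩` is infinite
cyclic and central.  If the extension satisfies condition `N`, i.e. there are a nilpotent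
group `N` and a surjective homomorphism `f : Γ̃ → N` with `f σ` of infinite order, then `Γ̃`
is residually finite. -/
theorem residuallyFinite_of_conditionN
    {Γt Γ : Type*} [Group Γt] [Group Γ] (hfg : Group.FG Γt)
    (π : Γt →* Γ) (hsurj : Function.Surjective π)
    (σ : Γt) (hker : π.ker = Subgroup.zpowers σ)
    (hcen : σ ∈ Subgroup.center Γt) (hinf : ¬ IsOfFinOrder σ)
    (hΓ : ResiduallyFinite Γ)
    (hN : ∃ (N : Type) (_ : Group N) (_ : Group.IsNilpotent N) (f : Γt →* N),
      Function.Surjective f ∧ ¬ IsOfFinOrder (f σ)) :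
    ResiduallyFinite Γt := by
  intro x hx
  by_cases hπ : π x = 1
  · obtain ⟨N, _, _, f, hf, hfσ⟩ := hN
    have : Group.FG N := Group.fg_of_surjective hf
    obtain ⟨k, rfl⟩ := Subgroup.mem_zpowers_iff.mp (hker ▸ π.mem_ker.mpr hπ)
    have hk : f (σ ^ k) ≠ 1 := fun h => hfσ <| isOfFinOrder_iff_zpow_eq_one.mpr
      ⟨k, by rintro rfl; simp at hx, by rwa [← map_zpow]⟩
    obtain ⟨M, hM, hfin, hkM⟩ := Group.IsNilpotent.exists_normal_finite_quotient hk
    exact ⟨N ⧸ M, inferInstance, hfin, (QuotientGroup.mk' M).comp f,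
      fun h => hkM ((QuotientGroup.eq_one_iff _).mp h)⟩
  · obtain ⟨F, hF, hfin, ρ, hρ⟩ := hΓ (π x) hπ
    exact ⟨F, hF, hfin, ρ.comp π, hρ⟩
end

section
/- Let 0 → ℤ → Γ̃ →^π Γ → 1 be a central extension of a residually finite group Γ by ℤ, and let σ ∈ Γ̃ denote the image of 1 ∈ ℤ. If for every integer d > 1 the quotient group Γ̃_d = Γ̃/⟨σ^d⟩ (the quotient of Γ̃ by the central subgroup generated by σ^d) is residually finite, then Γ̃ is residually finite. -/
/-- The cyclic subgroup generated by a central element is normal. -/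
theorem zpowers_normal_of_mem_center {G : Type*} [Group G] {x : G}
    (hx : x ∈ Subgroup.center G) : (Subgroup.zpowers x).Normal := by
  constructor
  intro n hn g
  rcases Subgroup.mem_zpowers_iff.1 hn with ⟨k, rfl⟩
  have hc : x ^ k ∈ Subgroup.center G := (Subgroup.center G).zpow_mem hx k
  rw [Subgroup.mem_center_iff.1 hc g, mul_inv_cancel_right]
  exact Subgroup.zpow_mem _ (Subgroup.mem_zpowers x) k

/-- Let `0 → ℤ → Γ̃ → Γ → 1` be a central extension of a residually finite group `Γ` by `ℤ`,
where `σ` is the image of `1 ∈ ℤ`, so `ker π = ⟨σ⟩` is infinite cyclic and central.  If for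
every integer `d > 1` the quotient `Γ̃ / ⟨σ ^ d⟩` is residually finite, then `Γ̃` is
residually finite. -/
theorem residuallyFinite_of_reductions_rf
    {Γt Γ : Type*} [Group Γt] [Group Γ]
    (π : Γt →* Γ) (hsurj : Function.Surjective π)
    (σ : Γt) (hker : π.ker = Subgroup.zpowers σ)
    (hcen : σ ∈ Subgroup.center Γt) (hinf : ¬ IsOfFinOrder σ)
    (hΓ : ResiduallyFinite Γ)
    (h : ∀ d : ℕ, 1 < d →
      haveI : (Subgroup.zpowers (σ ^ d)).Normal :=
        zpowers_normal_of_mem_center ((Subgroup.center Γt).pow_mem hcen d)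
      ResiduallyFinite (Γt ⧸ Subgroup.zpowers (σ ^ d))) :
    ResiduallyFinite Γt := by
  intro g hg
  by_cases hπ : π g = 1
  · obtain ⟨k, rfl⟩ : ∃ k : ℤ, σ ^ k = g :=
      Subgroup.mem_zpowers_iff.1 (hker ▸ MonoidHom.mem_ker.2 hπ)
    have hk : k ≠ 0 := by
      rintro rfl
      exact hg (zpow_zero σ)
    have hnormal : (Subgroup.zpowers (σ ^ (k.natAbs + 1))).Normal :=
      zpowers_normal_of_mem_center ((Subgroup.center Γt).pow_mem hcen _)
    have hmk : (QuotientGroup.mk' (Subgroup.zpowers (σ ^ (k.natAbs + 1)))) (σ ^ k) ≠ 1 := by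
      intro hone
      obtain ⟨m, hm⟩ := Subgroup.mem_zpowers_iff.1 ((QuotientGroup.eq_one_iff _).1 hone)
      rw [← zpow_natCast, ← zpow_mul] at hm
      have hdvd : ((k.natAbs + 1 : ℕ) : ℤ) ∣ k :=
        ⟨m, (injective_zpow_iff_not_isOfFinOrder.2 hinf hm).symm⟩
      have hle := Nat.le_of_dvd (Int.natAbs_pos.2 hk) (Int.natCast_dvd.1 hdvd)
      omega
    obtain ⟨F, hF, hfin, ρ, hρ⟩ := h (k.natAbs + 1) (by omega) _ hmk
    exact ⟨F, hF, hfin, ρ.comp (QuotientGroup.mk' _), hρ⟩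
  · obtain ⟨F, hF, hfin, ρ, hρ⟩ := hΓ (π g) hπ
    exact ⟨F, hF, hfin, ρ.comp π, hρ⟩
end

section
/- Let d ≥ 1 be an integer and let 1 → C → G →^π Γ → 1 be a central extension of a group Γ by a cyclic group C of order d (so C = ker π is a central subgroup of G of order d). If G is residually finite, then there exists a finite-index subgroup Λ ≤ Γ over which the extension is trivial: there is a subgroup K ≤ G with K ∩ C = {1} such that π restricts to an isomorphism from K onto Λ (equivalently, there is a homomorphism s: Λ → G with π ∘ s equal to the inclusion of Λ into Γ). -/
/-- In a residually finite group, every finite subgroup meets some finite-index subgroup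
trivially. -/
theorem ResiduallyFinite.exists_finiteIndex_disjoint {G : Type*} [Group G]
    (hG : ResiduallyFinite G) (C : Subgroup G) [Finite C] :
    ∃ K : Subgroup G, K.FiniteIndex ∧ Disjoint K C := by
  have hsep : ∀ c : {c : C // c ≠ 1}, ∃ N : Subgroup G, N.FiniteIndex ∧ ((c : C) : G) ∉ N := by
    rintro ⟨c, hc⟩
    obtain ⟨F, _, _, ρ, hρ⟩ := hG c (by simpa using hc)
    exact ⟨ρ.ker, inferInstance, by simpa [MonoidHom.mem_ker] using hρ⟩
  choose N hfin hN using hsep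
  refine ⟨⨅ c, N c, Subgroup.finiteIndex_iInf hfin, Subgroup.disjoint_def.mpr ?_⟩
  intro x hx hxC
  by_contra hne
  have hne' : (⟨x, hxC⟩ : C) ≠ 1 := by simpa [Subtype.ext_iff] using hne
  exact hN ⟨⟨x, hxC⟩, hne'⟩ (Subgroup.mem_iInf.mp hx _)

/-- A homomorphism whose kernel meets `K` trivially has a section over the image of `K`. -/
theorem MonoidHom.exists_section_map_of_disjoint_ker {G Γ : Type*} [Group G] [Group Γ]
    (π : G →* Γ) {K : Subgroup G} (hK : Disjoint K π.ker) :
    ∃ s : K.map π →* G, ∀ x : K.map π, π (s x) = (x : Γ) := by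
  have hinj : Function.Injective (π.subgroupMap K) := by
    rw [injective_iff_map_eq_one]
    intro x hx
    exact Subtype.ext (Subgroup.disjoint_def.mp hK x.2 (congrArg Subtype.val hx))
  let e := MulEquiv.ofBijective (π.subgroupMap K) ⟨hinj, π.subgroupMap_surjective K⟩
  exact ⟨K.subtype.comp e.symm.toMonoidHom, fun x => congrArg Subtype.val (e.apply_symm_apply x)⟩

/-- Let `d ≥ 1` and let `1 → C → G → Γ → 1` be a central extension of a group `Γ` by a
cyclic group `C = ker π` of order `d`, central in `G`.  If `G` is residually finite, then
there is a finite-index subgroup `Λ ≤ Γ` over which the extension is trivial: there is a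
homomorphism `s : Λ → G` with `π ∘ s` the inclusion of `Λ` into `Γ`. -/
theorem exists_finiteIndex_section_of_residuallyFinite
    {G Γ : Type*} [Group G] [Group Γ] (d : ℕ) (hd : 1 ≤ d)
    (π : G →* Γ) (hsurj : Function.Surjective π)
    (hcen : π.ker ≤ Subgroup.center G)
    (hcyc : IsCyclic π.ker) (hcard : Nat.card π.ker = d)
    (hG : ResiduallyFinite G) :
    ∃ Λ : Subgroup Γ, Λ.FiniteIndex ∧ ∃ s : Λ →* G, ∀ x : Λ, π (s x) = (x : Γ) := by
  have : Finite π.ker := Nat.finite_of_card_ne_zero (by omega)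
  obtain ⟨K, hfin, hK⟩ := hG.exists_finiteIndex_disjoint π.ker
  refine ⟨K.map π, ⟨?_⟩, π.exists_section_map_of_disjoint_ker hK⟩
  exact ne_zero_of_dvd_ne_zero hfin.index_ne_zero (K.index_map_dvd hsurj)
end
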